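/- (Expected degree for the extended affine Weyl group.) Write μ_{N,j}^{(m,n)} for the measure μ_{N,j} built from parameters (m,n), and μ_{N,j}^{(n,m)} for the one built with m and n interchanged. Define ρ_N = μ_{N,0}^{(m,n)} if N is even and ρ_N = μ_{N,1}^{(n,m)} if N is odd (this is the weight distribution of the Demazure module V_{(σs₀)^N}(Λ), where σ is the nontrivial Dynkin diagram automorphism), and define ρ'_N = μ_{N,1}^{(m,n)} if N is even and ρ'_N = μ_{N,0}^{(n,m)} if N is odd (the weight distribution of V_{(σs₁)^N}(Λ)). Then for all N ≥ 1: E_{ρ_N}[a] = ( 2(N−1)m(m+2) + (N−1)(N−2)(m+n)(m+n+2) ) / ( 12(m+n+1) ) + ⌊(N−1)/2⌋·n/2 + ⌊N/2⌋·m/2, and E_{ρ'_N}[a] = ( 2(N−1)n(n+2) + (N−1)(N−2)(m+n)(m+n+2) ) / ( 12(m+n+1) ) + ⌈(N−1)/2⌉·m/2 + ⌈N/2⌉·n/2. -/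

import Mathlib

open Finsupp Filter

noncomputable section

/-- Signed-sum convention: `signedSum c k = Σ_{i=0}^{k} c i`, which is the ordinary sum for
`k ≥ 0`, is `0` for `k = -1`, and equals `-(c (-1) + c (-2) + ⋯ + c (k+1))` for `k ≤ -2`. -/
def signedSum {M : Type*} [AddCommGroup M] (c : ℤ → M) (k : ℤ) : M :=
  (∑ i ∈ Finset.range (k + 1).toNat, c i) -
    ∑ i ∈ Finset.range (-(k + 1)).toNat, c (-((i : ℤ) + 1))

/-- The Demazure operator `D₀` (relative to `Λ = mΛ₀ + nΛ₁`):
`D₀ δ_{(a,b)} = Σ_{i=0}^{m - 2(a-b)} δ_{(a+i,b)}`, extended ℤ-linearly. -/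
def D0 (m : ℕ) (μ : ℤ × ℤ →₀ ℤ) : ℤ × ℤ →₀ ℤ :=
  μ.sum fun p c =>
    c • signedSum (fun i => Finsupp.single (p.1 + i, p.2) (1 : ℤ)) ((m : ℤ) - 2 * (p.1 - p.2))

/-- The Demazure operator `D₁` (relative to `Λ = mΛ₀ + nΛ₁`):
`D₁ δ_{(a,b)} = Σ_{i=0}^{n + 2(a-b)} δ_{(a,b+i)}`, extended ℤ-linearly. -/
def D1 (n : ℕ) (μ : ℤ × ℤ →₀ ℤ) : ℤ × ℤ →₀ ℤ :=
  μ.sum fun p c =>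
    c • signedSum (fun i => Finsupp.single (p.1, p.2 + i) (1 : ℤ)) ((n : ℤ) + 2 * (p.1 - p.2))

/-- Total mass `μ(Γ)` of a finitely supported function on `ℤ × ℤ`. -/
def mass (μ : ℤ × ℤ →₀ ℤ) : ℤ := μ.sum fun _ c => c

/-- Expected value `E_ν[f] = (1/ν(Γ)) Σ ν(a,b) f(a,b)`. -/
def expVal (ν : ℤ × ℤ →₀ ℤ) (f : ℤ × ℤ → ℚ) : ℚ :=
  (mass ν : ℚ)⁻¹ * ν.sum fun p c => (c : ℚ) * f p

/-- Covariance `Cov_ν(f,g) = E_ν[f·g] - E_ν[f]·E_ν[g]`. -/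
def cov (ν : ℤ × ℤ →₀ ℤ) (f g : ℤ × ℤ → ℚ) : ℚ :=
  expVal ν (fun p => f p * g p) - expVal ν f * expVal ν g

/-- Variance `Var_ν(f) = Cov_ν(f,f)`. -/
def var (ν : ℤ × ℤ →₀ ℤ) (f : ℤ × ℤ → ℚ) : ℚ := cov ν f f

/-- The coordinate function `a` (the degree). -/
def fa : ℤ × ℤ → ℚ := fun p => (p.1 : ℚ)

/-- The coordinate function `b`. -/
def fb : ℤ × ℤ → ℚ := fun p => (p.2 : ℚ)

/-- The finite-weight coordinate `a - b`. -/
def fab : ℤ × ℤ → ℚ := fun p => (p.1 : ℚ) - (p.2 : ℚ)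

/-- `μ_{N,0}`: start from `δ_{(0,0)}`, apply `D₀` at odd steps and `D₁` at even steps. -/
def mu0 (m n : ℕ) : ℕ → (ℤ × ℤ →₀ ℤ)
  | 0 => Finsupp.single (0, 0) 1
  | N + 1 => if N % 2 = 0 then D0 m (mu0 m n N) else D1 n (mu0 m n N)

/-- `μ_{N,1}`: start from `δ_{(0,0)}`, apply `D₁` at odd steps and `D₀` at even steps. -/
def mu1 (m n : ℕ) : ℕ → (ℤ × ℤ →₀ ℤ)
  | 0 => Finsupp.single (0, 0) 1
  | N + 1 => if N % 2 = 0 then D1 n (mu1 m n N) else D0 m (mu1 m n N)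

lemma signedSum_neg_one {M : Type*} [AddCommGroup M] (c : ℤ → M) : signedSum c (-1) = 0 := by
  simp [signedSum]

lemma signedSum_add_one {M : Type*} [AddCommGroup M] (c : ℤ → M) (k : ℤ) :
    signedSum c (k + 1) = signedSum c k + c (k + 1) := by
  unfold signedSum
  rcases le_or_gt 0 (k + 1) with h | h
  · obtain ⟨j, hj⟩ := Int.eq_ofNat_of_zero_le h
    have h1 : (k + 1 + 1).toNat = j + 1 := by omega
    have h2 : (k + 1).toNat = j := by omega
    have h3 : (-(k + 1 + 1)).toNat = 0 := by omega
    have h4 : (-(k + 1)).toNat = 0 := by omega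
    rw [h1, h2, h3, h4, Finset.sum_range_succ, hj]
    simp
  · obtain ⟨j, hj⟩ := Int.eq_ofNat_of_zero_le (show 0 ≤ -(k + 1 + 1) by omega)
    have h1 : (k + 1 + 1).toNat = 0 := by omega
    have h2 : (k + 1).toNat = 0 := by omega
    have h3 : (-(k + 1 + 1)).toNat = j := by omega
    have h4 : (-(k + 1)).toNat = j + 1 := by omega
    have h5 : k + 1 = -((j : ℤ) + 1) := by omega
    rw [h1, h2, h3, h4, Finset.sum_range_succ, h5]
    simp

/-- Discrete fundamental theorem of calculus for `signedSum`. -/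
lemma signedSum_eq_of_add_one {M : Type*} [AddCommGroup M] {c F : ℤ → M} (h0 : F (-1) = 0)
    (h : ∀ k, F (k + 1) = F k + c (k + 1)) (k : ℤ) : signedSum c k = F k := by
  induction k using Int.inductionOn' (b := -1) with
  | zero => rw [signedSum_neg_one, h0]
  | succ k _ ih => rw [signedSum_add_one, h, ih]
  | pred k _ ih =>
    have h1 := signedSum_add_one c (k - 1)
    have h2 := h (k - 1)
    rw [sub_add_cancel] at h1 h2
    rw [h1, h2] at ih
    exact add_right_cancel ih

lemma map_signedSum {M M' : Type*} [AddCommGroup M] [AddCommGroup M'] (φ : M →+ M') (c : ℤ → M)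
    (k : ℤ) : φ (signedSum c k) = signedSum (fun i => φ (c i)) k := by
  simp [signedSum]

lemma signedSum_const (r : ℚ) (k : ℤ) : signedSum (fun _ => r) k = (k + 1) * r := by
  refine signedSum_eq_of_add_one (F := fun k : ℤ => ((k : ℚ) + 1) * r) (by simp) ?_ k
  intro k
  push_cast
  ring

lemma signedSum_const_mul (r : ℚ) (c : ℤ → ℚ) (k : ℤ) :
    signedSum (fun i => r * c i) k = r * signedSum c k := by
  simp [signedSum, mul_sub, Finset.mul_sum]

lemma signedSum_sub_half (k : ℤ) : signedSum (fun i : ℤ => (i : ℚ) - k / 2) k = 0 := by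
  have h (r : ℚ) := signedSum_eq_of_add_one (c := fun i : ℤ => (i : ℚ) - r)
    (F := fun k : ℤ => ((k : ℚ) + 1) * (k / 2 - r)) (by simp)
    (fun k => by push_cast; ring) k
  rw [h]
  ring

lemma signedSum_sub_half_sq (k : ℤ) :
    signedSum (fun i : ℤ => ((i : ℚ) - k / 2) ^ 2) k = (k : ℚ) * (k + 1) * (k + 2) / 12 := by
  have h (r : ℚ) := signedSum_eq_of_add_one (c := fun i : ℤ => ((i : ℚ) - r) ^ 2)
    (F := fun k : ℤ => ((k : ℚ) + 1) * (k * (2 * k + 1) / 6 - r * k + r ^ 2)) (by simp)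
    (fun k => by push_cast; ring) k
  rw [h]
  ring

lemma signedSum_sub_half_cube (k : ℤ) :
    signedSum (fun i : ℤ => ((i : ℚ) - k / 2) ^ 3) k = 0 := by
  have h (r : ℚ) := signedSum_eq_of_add_one (c := fun i : ℤ => ((i : ℚ) - r) ^ 3)
    (F := fun k : ℤ => ((k : ℚ) + 1) *
      (k ^ 2 * (k + 1) / 4 - r * k * (2 * k + 1) / 2 + 3 * r ^ 2 * k / 2 - r ^ 3)) (by simp)
    (fun k => by push_cast; ring) k
  rw [h]
  ring

/-- The pairing `Σ ν(a,b) f(a,b)` of a finitely supported function with a function, as an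
additive map in the first argument. -/
def pairing (f : ℤ × ℤ → ℚ) : (ℤ × ℤ →₀ ℤ) →+ ℚ :=
  Finsupp.liftAddHom fun p => (AddMonoidHom.mulRight (f p)).comp (Int.castAddHom ℚ)

lemma pairing_apply (f : ℤ × ℤ → ℚ) (ν : ℤ × ℤ →₀ ℤ) :
    pairing f ν = ν.sum fun p c => (c : ℚ) * f p := rfl

lemma pairing_single (f : ℤ × ℤ → ℚ) (p : ℤ × ℤ) : pairing f (single p 1) = f p := by
  simp [pairing_apply]

lemma pairing_add (f g : ℤ × ℤ → ℚ) (ν : ℤ × ℤ →₀ ℤ) :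
    pairing (fun p => f p + g p) ν = pairing f ν + pairing g ν := by
  simp [pairing_apply, Finsupp.sum, mul_add, Finset.sum_add_distrib]

lemma pairing_const_mul (r : ℚ) (f : ℤ × ℤ → ℚ) (ν : ℤ × ℤ →₀ ℤ) :
    pairing (fun p => r * f p) ν = r * pairing f ν := by
  simp [pairing_apply, Finsupp.sum, Finset.mul_sum, mul_left_comm]

lemma expVal_eq_pairing (ν : ℤ × ℤ →₀ ℤ) (f : ℤ × ℤ → ℚ) :
    expVal ν f = (pairing (fun _ => 1) ν)⁻¹ * pairing f ν := by
  simp [expVal, mass, pairing_apply, Finsupp.sum]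

lemma pairing_D0 (m : ℕ) (ν : ℤ × ℤ →₀ ℤ) (f : ℤ × ℤ → ℚ) :
    pairing f (D0 m ν) = pairing
      (fun p => signedSum (fun i => f (p.1 + i, p.2)) ((m : ℤ) - 2 * (p.1 - p.2))) ν := by
  simp only [D0, Finsupp.sum, map_sum, map_zsmul, map_signedSum, pairing_single, zsmul_eq_mul,
    pairing_apply _ ν]

lemma pairing_D1 (n : ℕ) (ν : ℤ × ℤ →₀ ℤ) (f : ℤ × ℤ → ℚ) :
    pairing f (D1 n ν) = pairing
      (fun p => signedSum (fun i => f (p.1, p.2 + i)) ((n : ℤ) + 2 * (p.1 - p.2))) ν := by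
  simp only [D1, Finsupp.sum, map_sum, map_zsmul, map_signedSum, pairing_single, zsmul_eq_mul,
    pairing_apply _ ν]

/-- The diagram automorphism exchanges the two families of measures. -/
lemma pairing_mu1 (m n N : ℕ) (f : ℤ × ℤ → ℚ) :
    pairing f (mu1 n m N) = pairing (fun p => f p.swap) (mu0 m n N) := by
  induction N generalizing f with
  | zero => simp [mu0, mu1, pairing_single]
  | succ N ih =>
    rw [mu0, mu1]
    split_ifs
    · rw [pairing_D0, pairing_D1, ih]
      congr! 4 with p
      simp only [Prod.fst_swap, Prod.snd_swap]
      ring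
    · rw [pairing_D0, pairing_D1, ih]
      congr! 4 with p
      simp only [Prod.fst_swap, Prod.snd_swap]
      ring

/-- Moments of a measure in a coordinate `y`, whose odd moments vanish, and a coordinate `t`
uncorrelated with `y`: total mass `M`, variance `V` of `y` and expected value `E` of `t`. -/
structure HasMoments (ν : ℤ × ℤ →₀ ℤ) (y t : ℤ × ℤ → ℚ) (M V E : ℚ) : Prop where
  one : pairing (fun _ => 1) ν = M
  fst : pairing y ν = 0
  sq : pairing (fun p => y p ^ 2) ν = M * V
  cube : pairing (fun p => y p ^ 3) ν = 0
  snd : pairing t ν = M * E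
  mul : pairing (fun p => y p * t p) ν = 0

/-- Evolution of the moments when each point is replaced by a string of length `k + 1`, the new
coordinate `y'` being centred on each string and `t'` being constant along it. -/
lemma HasMoments.string {ν ν' : ℤ × ℤ →₀ ℤ} {y t y' t' : ℤ × ℤ → ℚ} {M V E r L : ℚ}
    (h : HasMoments ν y t M V E) (hL : L ≠ 0) (k : ℤ × ℤ → ℤ) (pt : ℤ × ℤ → ℤ → ℤ × ℤ)
    (hν : ∀ f, pairing f ν' = pairing (fun p => signedSum (fun i => f (pt p i)) (k p)) ν)
    (hk : ∀ p, (k p : ℚ) + 1 = L + 2 * y p)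
    (hy : ∀ p i, y' (pt p i) = (i : ℚ) - (k p : ℚ) / 2)
    (ht : ∀ p i, t' (pt p i) = t p + y p + r / 2) :
    HasMoments ν' y' t' (L * M) (V + (L ^ 2 - 1) / 12) (E + r / 2 + 2 * V / L) where
  one := by
    have e : (fun p => ((k p : ℚ) + 1) * 1) = fun p => L * 1 + 2 * y p := by
      funext p
      rw [hk, mul_one, mul_one]
    simp only [hν, signedSum_const]
    rw [e, pairing_add, pairing_const_mul, pairing_const_mul, h.one, h.fst]
    ring
  fst := by
    simp only [hν, hy, signedSum_sub_half]
    simp [pairing_apply]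
  sq := by
    have e : (fun p => (k p : ℚ) * (k p + 1) * (k p + 2) / 12) = fun p =>
        (L ^ 3 - L) / 12 * 1 + ((3 * L ^ 2 - 1) / 6 * y p + (L * y p ^ 2 + 2 / 3 * y p ^ 3)) := by
      funext p
      rw [eq_sub_of_add_eq (hk p)]
      ring
    simp only [hν, hy, signedSum_sub_half_sq]
    rw [e]
    simp only [pairing_add, pairing_const_mul, h.one, h.fst, h.sq, h.cube]
    ring
  cube := by
    simp only [hν, hy, signedSum_sub_half_cube]
    simp [pairing_apply]
  snd := by
    have e : (fun p => ((k p : ℚ) + 1) * (t p + y p + r / 2)) = fun p =>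
        L * r / 2 * 1 + ((L + r) * y p + (2 * y p ^ 2 + (L * t p + 2 * (y p * t p)))) := by
      funext p
      rw [hk]
      ring
    simp only [hν, ht, signedSum_const]
    rw [e]
    simp only [pairing_add, pairing_const_mul, h.one, h.fst, h.sq, h.snd, h.mul]
    field_simp
    ring
  mul := by
    simp only [hν, hy, ht, mul_comm, signedSum_const_mul, signedSum_sub_half]
    simp [pairing_apply]

lemma HasMoments.D0 {ν : ℤ × ℤ →₀ ℤ} {M V E : ℚ} (m n : ℕ)
    (h : HasMoments ν (fun p => p.2 - p.1 - n / 2) fa M V E) :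
    HasMoments (D0 m ν) (fun p => p.1 - p.2 - m / 2) fb (((m : ℚ) + n + 1) * M)
      (V + (((m : ℚ) + n + 1) ^ 2 - 1) / 12) (E + n / 2 + 2 * V / ((m : ℚ) + n + 1)) := by
  refine h.string (by positivity) _ _ (pairing_D0 m ν) ?_ ?_ ?_ <;> intros <;>
    (try simp only [fa, fb]) <;> push_cast <;> ring

lemma HasMoments.D1 {ν : ℤ × ℤ →₀ ℤ} {M V E : ℚ} (m n : ℕ)
    (h : HasMoments ν (fun p => p.1 - p.2 - m / 2) fb M V E) :
    HasMoments (D1 n ν) (fun p => p.2 - p.1 - n / 2) fa (((m : ℚ) + n + 1) * M)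
      (V + (((m : ℚ) + n + 1) ^ 2 - 1) / 12) (E + m / 2 + 2 * V / ((m : ℚ) + n + 1)) := by
  refine h.string (by positivity) _ _ (pairing_D1 n ν) ?_ ?_ ?_ <;> intros <;>
    (try simp only [fa, fb]) <;> push_cast <;> ring

lemma mu0_odd (m n j : ℕ) : mu0 m n (2 * j + 1) = D0 m (mu0 m n (2 * j)) := by
  rw [mu0, if_pos (by omega)]

lemma mu0_even (m n j : ℕ) : mu0 m n (2 * j + 2) = D1 n (mu0 m n (2 * j + 1)) := by
  rw [mu0, if_neg (by omega)]

lemma hasMoments_mu0_odd (m n j : ℕ) :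
    HasMoments (mu0 m n (2 * j + 1)) (fun p => p.1 - p.2 - m / 2) fb
      (((m : ℚ) + 1) * ((m : ℚ) + n + 1) ^ (2 * j))
      (((m : ℚ) * (m + 2) + 2 * j * (((m : ℚ) + n) * (m + n + 2))) / 12)
      ((4 * j * (m : ℚ) * (m + 2) + 2 * j * (2 * j - 1) * ((m : ℚ) + n) * (m + n + 2)) /
        (12 * ((m : ℚ) + n + 1)) + j * n / 2 + j * m / 2) := by
  have hL : (m : ℚ) + n + 1 ≠ 0 := by positivity
  induction j with
  | zero =>
    have h0 : HasMoments (mu0 m n 0) (fun p => p.2 - p.1 - (0 : ℕ) / 2) fa 1 0 0 := by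
      constructor <;> rw [mu0, pairing_single] <;> simp [fa]
    rw [mu0_odd]
    convert h0.D0 m 0 using 1 <;> simp
    ring
  | succ j ih =>
    have h2 := (ih.D1 m n).D0 m n
    rw [← mu0_even, show 2 * j + 2 = 2 * (j + 1) by ring, ← mu0_odd] at h2
    convert h2 using 1
    · ring
    · push_cast
      ring
    · push_cast
      field_simp
      ring

lemma hasMoments_mu0_even (m n j : ℕ) :
    HasMoments (mu0 m n (2 * j + 2)) (fun p => p.2 - p.1 - n / 2) fa
      (((m : ℚ) + 1) * ((m : ℚ) + n + 1) ^ (2 * j + 1))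
      (((m : ℚ) * (m + 2) + (2 * j + 1) * (((m : ℚ) + n) * (m + n + 2))) / 12)
      ((2 * (2 * j + 1) * (m : ℚ) * (m + 2) +
        (2 * j + 1) * (2 * j) * ((m : ℚ) + n) * (m + n + 2)) /
        (12 * ((m : ℚ) + n + 1)) + j * n / 2 + (j + 1) * m / 2) := by
  have hL : (m : ℚ) + n + 1 ≠ 0 := by positivity
  rw [mu0_even]
  convert (hasMoments_mu0_odd m n j).D1 m n using 1
  · ring
  · ring
  · field_simp
    ring

lemma expVal_mu1 (m n N : ℕ) (f : ℤ × ℤ → ℚ) :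
    expVal (mu1 n m N) f = expVal (mu0 m n N) (fun p => f p.swap) := by
  simp only [expVal_eq_pairing, pairing_mu1]

lemma HasMoments.expVal_snd {ν : ℤ × ℤ →₀ ℤ} {y t : ℤ × ℤ → ℚ} {M V E : ℚ}
    (h : HasMoments ν y t M V E) (hM : M ≠ 0) : expVal ν t = E := by
  rw [expVal_eq_pairing, h.one, h.snd, inv_mul_cancel_left₀ hM]

lemma HasMoments.expVal_add {ν : ℤ × ℤ →₀ ℤ} {y t f : ℤ × ℤ → ℚ} {M V E r : ℚ}
    (h : HasMoments ν y t M V E) (hM : M ≠ 0) (hf : ∀ p, f p = t p + y p + r) :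
    expVal ν f = E + r := by
  have e : f = fun p => t p + (y p + r * 1) := by
    funext p
    rw [hf]
    ring
  rw [expVal_eq_pairing, e, pairing_add, pairing_add, pairing_const_mul, h.one, h.fst, h.snd]
  field_simp
  ring

/-- expected degree for the extended affine Weyl group: with
`ρ_N = μ_{N,0}^{(m,n)}` for even `N` and `μ_{N,1}^{(n,m)}` for odd `N` (the weight
distribution of `V_{(σs₀)^N}(Λ)`), and `ρ'_N = μ_{N,1}^{(m,n)}` for even `N` and
`μ_{N,0}^{(n,m)}` for odd `N` (that of `V_{(σs₁)^N}(Λ)`), the expected degrees for `N ≥ 1`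
are as stated; here `⌈(N-1)/2⌉ = N/2` and `⌈N/2⌉ = (N+1)/2` in natural division. -/
theorem stmt_19 (m n : ℕ) (N : ℕ) (hN : 1 ≤ N) :
    expVal (if N % 2 = 0 then mu0 m n N else mu1 n m N) fa =
      (2 * ((N : ℚ) - 1) * (m : ℚ) * ((m : ℚ) + 2) +
        ((N : ℚ) - 1) * ((N : ℚ) - 2) * ((m : ℚ) + (n : ℚ)) * ((m : ℚ) + (n : ℚ) + 2)) /
        (12 * ((m : ℚ) + (n : ℚ) + 1)) +
      (((N - 1) / 2 : ℕ) : ℚ) * (n : ℚ) / 2 + ((N / 2 : ℕ) : ℚ) * (m : ℚ) / 2 ∧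
    expVal (if N % 2 = 0 then mu1 m n N else mu0 n m N) fa =
      (2 * ((N : ℚ) - 1) * (n : ℚ) * ((n : ℚ) + 2) +
        ((N : ℚ) - 1) * ((N : ℚ) - 2) * ((m : ℚ) + (n : ℚ)) * ((m : ℚ) + (n : ℚ) + 2)) /
        (12 * ((m : ℚ) + (n : ℚ) + 1)) +
      ((N / 2 : ℕ) : ℚ) * (m : ℚ) / 2 + (((N + 1) / 2 : ℕ) : ℚ) * (n : ℚ) / 2 := by
  have odd_mass (m n j : ℕ) : ((m : ℚ) + 1) * ((m : ℚ) + n + 1) ^ (2 * j) ≠ 0 := by positivity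
  have even_mass (m n j : ℕ) : ((m : ℚ) + 1) * ((m : ℚ) + n + 1) ^ (2 * j + 1) ≠ 0 := by
    positivity
  obtain ⟨j, rfl | rfl⟩ : ∃ j, N = 2 * j + 1 ∨ N = 2 * j + 2 := ⟨(N - 1) / 2, by omega⟩
  · have h1 : (2 * j + 1) % 2 ≠ 0 := by omega
    have h2 : (2 * j + 1 - 1) / 2 = j := by omega
    have h3 : (2 * j + 1) / 2 = j := by omega
    have h4 : (2 * j + 1 + 1) / 2 = j + 1 := by omega
    rw [if_neg h1, if_neg h1, h2, h3, h4, expVal_mu1]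
    refine ⟨((hasMoments_mu0_odd m n j).expVal_snd (odd_mass m n j)).trans ?_,
      ((hasMoments_mu0_odd n m j).expVal_add (f := fa) (r := (n : ℚ) / 2) (odd_mass n m j)
        fun p => by simp only [fa, fb]; ring).trans ?_⟩
    · push_cast
      ring
    · rw [add_comm (n : ℚ) m]
      push_cast
      ring
  · have h1 : (2 * j + 2) % 2 = 0 := by omega
    have h2 : (2 * j + 2 - 1) / 2 = j := by omega
    have h3 : (2 * j + 2) / 2 = j + 1 := by omega
    have h4 : (2 * j + 2 + 1) / 2 = j + 1 := by omega
    rw [if_pos h1, if_pos h1, h2, h3, h4, expVal_mu1]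
    refine ⟨((hasMoments_mu0_even m n j).expVal_snd (even_mass m n j)).trans ?_,
      ((hasMoments_mu0_even n m j).expVal_add (r := (m : ℚ) / 2) (even_mass n m j)
        fun p => by simp only [fa, Prod.fst_swap]; ring).trans ?_⟩
    · push_cast
      ring
    · rw [add_comm (n : ℚ) m]
      push_cast
      ring
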